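/- For n ≥ 4, the degree of the function (Maj,rev)-MM_n equals 2^⌊log₂⌊n/2⌋⌋. -/

import Mathlib

abbrev BF (n : ℕ) := (Fin n → ZMod 2) → ZMod 2

/-- Hamming weight of a vector in `F₂ⁿ`. -/
def wtv {n : ℕ} (x : Fin n → ZMod 2) : ℕ :=
  (Finset.univ.filter fun i => x i = 1).card

/-- ANF coefficient `a_α = ⊕_{z ≤ α} f(z)`. -/
def anf {n : ℕ} (f : BF n) (α : Fin n → ZMod 2) : ZMod 2 :=
  ∑ z ∈ Finset.univ.filter (fun z : Fin n → ZMod 2 => ∀ i, z i = 1 → α i = 1), f z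

/-- Algebraic degree: the maximum weight of `α` with nonzero ANF coefficient
(0 for the zero function). -/
def degBF {n : ℕ} (f : BF n) : ℕ :=
  (Finset.univ.filter fun α => anf f α ≠ 0).sup wtv

/-- Algebraic immunity: minimum degree of a nonzero annihilator of `f` or of `1 ⊕ f`. -/
noncomputable def AI {n : ℕ} (f : BF n) : ℕ :=
  sInf {d : ℕ | ∃ g : BF n, g ≠ 0 ∧ degBF g = d ∧
    ((∀ x, g x * f x = 0) ∨ (∀ x, g x * (1 + f x) = 0))}

/-- Inner product over F₂. -/
def ip {m : ℕ} (x y : Fin m → ZMod 2) : ZMod 2 := ∑ i, x i * y i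

/-- The m-variable majority function: 1 iff the weight exceeds ⌊m/2⌋. -/
def majF (m : ℕ) : BF m := fun x => if m / 2 < wtv x then 1 else 0

/-- The bit reversal permutation of F₂^m. -/
def revPerm (m : ℕ) : (Fin m → ZMod 2) → (Fin m → ZMod 2) := fun x i => x i.rev

/-- (Maj,rev)-MM_{2m}(X,Y) = ⟨rev(X),Y⟩ ⊕ Maj_m(X) on 2m variables. -/
def MMrevEven (m : ℕ) : BF (m + m) :=
  fun u => ip (revPerm m fun i => u (Fin.castAdd m i)) (fun i => u (Fin.natAdd m i))
    + majF m (fun i => u (Fin.castAdd m i))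

/-- (Maj,rev)-MM_{2m+1}(W,X,Y) = W ⊕ (Maj,rev)-MM_{2m}(X,Y) on 2m+1 variables. -/
def MMrevOdd (m : ℕ) : BF (m + m + 1) :=
  fun u => u (Fin.last (m + m)) + MMrevEven m (fun i => u i.castSucc)

/-- The indicator vector of a finset of coordinates. -/
def indVec {n : ℕ} (s : Finset (Fin n)) : Fin n → ZMod 2 := fun i => if i ∈ s then 1 else 0

/-- The support of a vector over `F₂`. -/
def suppVec {n : ℕ} (x : Fin n → ZMod 2) : Finset (Fin n) := Finset.univ.filter fun i => x i = 1

lemma mem_suppVec {n : ℕ} {x : Fin n → ZMod 2} {i : Fin n} : i ∈ suppVec x ↔ x i = 1 := by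
  simp [suppVec]

lemma indVec_eq_one {n : ℕ} {s : Finset (Fin n)} {i : Fin n} : indVec s i = 1 ↔ i ∈ s := by
  simp [indVec]

lemma suppVec_indVec {n : ℕ} (s : Finset (Fin n)) : suppVec (indVec s) = s := by
  ext i
  rw [mem_suppVec, indVec_eq_one]

lemma indVec_suppVec {n : ℕ} (x : Fin n → ZMod 2) : indVec (suppVec x) = x := by
  funext i
  have h : ∀ a : ZMod 2, (if a = 1 then (1 : ZMod 2) else 0) = a := by decide
  simpa [indVec, mem_suppVec] using h (x i)

lemma wtv_eq_card_suppVec {n : ℕ} (x : Fin n → ZMod 2) : wtv x = (suppVec x).card := rfl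

lemma anf_eq_sum_powerset {n : ℕ} (f : BF n) (α : Fin n → ZMod 2) :
    anf f α = ∑ s ∈ (suppVec α).powerset, f (indVec s) := by
  unfold anf
  refine Finset.sum_nbij' suppVec indVec ?_ ?_ (fun z _ => indVec_suppVec z)
    (fun s _ => suppVec_indVec s) (fun z _ => by rw [indVec_suppVec])
  · intro z hz
    rw [Finset.mem_filter] at hz
    rw [Finset.mem_powerset]
    intro i hi
    exact mem_suppVec.2 (hz.2 i (mem_suppVec.1 hi))
  · intro s hs
    rw [Finset.mem_powerset] at hs
    rw [Finset.mem_filter]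
    exact ⟨Finset.mem_univ _, fun i hi => mem_suppVec.1 (hs (indVec_eq_one.1 hi))⟩

lemma anf_add {n : ℕ} (f g : BF n) (α : Fin n → ZMod 2) :
    anf (fun u => f u + g u) α = anf f α + anf g α :=
  Finset.sum_add_distrib

lemma anf_sum {n : ℕ} {ι : Type*} (t : Finset ι) (f : ι → BF n) (α : Fin n → ZMod 2) :
    anf (fun u => ∑ i ∈ t, f i u) α = ∑ i ∈ t, anf (f i) α :=
  Finset.sum_comm

/-- A function that does not depend on a coordinate has no monomial containing it. -/
lemma anf_eq_zero_of_indep {n : ℕ} {f : BF n} {α : Fin n → ZMod 2} (i : Fin n) (hi : α i = 1)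
    (hf : ∀ u v : Fin n → ZMod 2, (∀ j, j ≠ i → u j = v j) → f u = f v) : anf f α = 0 := by
  rw [anf_eq_sum_powerset, ← Finset.insert_erase (mem_suppVec.2 hi),
    Finset.sum_powerset_insert (Finset.notMem_erase i _), ← Finset.sum_add_distrib]
  refine Finset.sum_eq_zero fun s _ => ?_
  rw [hf (indVec (insert i s)) (indVec s) fun j hj => by simp [indVec, hj]]
  exact CharTwo.add_self_eq_zero _

lemma anf_mul_eq_zero {n : ℕ} (a b : Fin n) {α : Fin n → ZMod 2} (hα : 2 < wtv α) :
    anf (fun u => u a * u b) α = 0 := by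
  obtain ⟨i, hi, hab⟩ := Finset.exists_mem_notMem_of_card_lt_card
    (lt_of_le_of_lt (Finset.card_le_two (a := a) (b := b)) (wtv_eq_card_suppVec α ▸ hα))
  simp only [Finset.mem_insert, Finset.mem_singleton, not_or] at hab
  refine anf_eq_zero_of_indep i (mem_suppVec.1 hi) fun u v h => ?_
  rw [h a (Ne.symm hab.1), h b (Ne.symm hab.2)]

lemma anf_coord_eq_zero {n : ℕ} (a : Fin n) {α : Fin n → ZMod 2} (hα : 2 < wtv α) :
    anf (fun u => u a) α = 0 := by
  have h : (fun u : Fin n → ZMod 2 => u a) = fun u => u a * u a := by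
    have h2 : ∀ x : ZMod 2, x = x * x := by decide
    exact funext fun u => h2 (u a)
  rw [h]
  exact anf_mul_eq_zero a a hα

lemma sum_range_choose_tail (w t N : ℕ) :
    ∑ j ∈ Finset.range (N + 1), ((w + 1).choose j : ZMod 2) * (if t < j then 1 else 0) =
      if t ≤ N then (w.choose t : ZMod 2) + w.choose N else 0 := by
  induction N with
  | zero =>
    rcases Nat.eq_zero_or_pos t with rfl | ht
    · simpa using (CharTwo.add_self_eq_zero (1 : ZMod 2)).symm
    · simp [ht.ne']
  | succ N ih =>
    rw [Finset.sum_range_succ, ih]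
    rcases lt_trichotomy t (N + 1) with h | rfl | h
    · rw [if_pos (by omega), if_pos h, if_pos h.le, Nat.choose_succ_succ, Nat.cast_add]
      linear_combination CharTwo.add_self_eq_zero (w.choose N : ZMod 2)
    · simp [CharTwo.add_self_eq_zero]
    · rw [if_neg (by omega), if_neg (by omega), if_neg (by omega)]
      simp

/-- The ANF of a threshold function depends on binomial coefficients mod 2 only. -/
lemma sum_powerset_threshold {β : Type*} (S : Finset β) (t w : ℕ) (hS : S.card = w + 1) :
    ∑ s ∈ S.powerset, (if t < s.card then (1 : ZMod 2) else 0) = w.choose t := by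
  rw [Finset.sum_powerset_apply_card (fun j => if t < j then (1 : ZMod 2) else 0), hS]
  simp only [nsmul_eq_mul]
  rw [sum_range_choose_tail, Nat.choose_succ_self]
  split_ifs with h
  · simp
  · rw [Nat.choose_eq_zero_of_lt (by omega), Nat.cast_zero]

lemma wtv_comp_indVec {p n : ℕ} {σ : Fin p → Fin n} (hσ : Function.Injective σ)
    {s : Finset (Fin n)} (hs : ∀ i ∈ s, i ∈ Set.range σ) :
    wtv (fun i => indVec s (σ i)) = s.card := by
  rw [wtv_eq_card_suppVec, ← Finset.card_image_of_injective _ hσ]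
  congr 1
  ext i
  simp only [Finset.mem_image, mem_suppVec, indVec_eq_one]
  constructor
  · rintro ⟨j, hj, rfl⟩
    exact hj
  · intro hi
    obtain ⟨j, rfl⟩ := hs i hi
    exact ⟨j, hi, rfl⟩

lemma anf_majF_comp {p n : ℕ} {σ : Fin p → Fin n} (hσ : Function.Injective σ)
    {α : Fin n → ZMod 2} (hα : ∀ i, α i = 1 → i ∈ Set.range σ) {w : ℕ} (hw : wtv α = w + 1) :
    anf (fun u => majF p fun i => u (σ i)) α = w.choose (p / 2) := by
  rw [anf_eq_sum_powerset, ← sum_powerset_threshold (suppVec α) (p / 2) w hw]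
  refine Finset.sum_congr rfl fun s hs => ?_
  rw [Finset.mem_powerset] at hs
  rw [majF, wtv_comp_indVec hσ fun i hi => hα i (mem_suppVec.1 (hs hi))]

lemma choose_two_pow_eq_zero {k j : ℕ} (hj : j ≠ 0) (hjk : j < 2 ^ k) :
    ((2 ^ k).choose j : ZMod 2) = 0 :=
  (ZMod.natCast_eq_zero_iff _ _).2 (Nat.prime_two.dvd_choose_pow hj hjk.ne)

lemma choose_two_pow_sub_one (k j : ℕ) (hj : j < 2 ^ k) :
    ((2 ^ k - 1).choose j : ZMod 2) = 1 := by
  induction j with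
  | zero => simp
  | succ j ih =>
    have h := choose_two_pow_eq_zero (k := k) (Nat.succ_ne_zero j) hj
    obtain ⟨q, hq⟩ : ∃ q, 2 ^ k = q + 1 := ⟨2 ^ k - 1, by omega⟩
    rw [hq] at h ih hj ⊢
    rw [Nat.succ_eq_add_one, Nat.choose_succ_succ, Nat.cast_add] at h
    rw [Nat.add_sub_cancel] at ih ⊢
    rw [ih (by omega)] at h
    exact (CharTwo.add_eq_zero.1 h).symm

lemma choose_two_pow_add (k r j : ℕ) (hr : r < j) (hj : j < 2 ^ k) :
    ((2 ^ k + r).choose j : ZMod 2) = 0 := by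
  rw [Nat.add_choose_eq, Nat.cast_sum]
  refine Finset.sum_eq_zero fun ⟨a, b⟩ hab => ?_
  rw [Finset.HasAntidiagonal.mem_antidiagonal] at hab
  dsimp only at hab ⊢
  rcases Nat.eq_zero_or_pos a with rfl | ha
  · rw [Nat.choose_eq_zero_of_lt (show r < b by omega), mul_zero, Nat.cast_zero]
  · rw [Nat.cast_mul, choose_two_pow_eq_zero ha.ne' (by omega), zero_mul]

lemma wtv_le_of_supported {p n : ℕ} {σ : Fin p → Fin n} {α : Fin n → ZMod 2}
    (hα : ∀ i, α i = 1 → i ∈ Set.range σ) : wtv α ≤ p := by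
  have h : suppVec α ⊆ Finset.univ.image σ := fun i hi => by
    simpa using hα i (mem_suppVec.1 hi)
  rw [wtv_eq_card_suppVec]
  exact (Finset.card_le_card h).trans (Finset.card_image_le.trans (by simp))

/-- Adding to majority on part of the variables a function of degree at most two that vanishes
on these variables does not change the degree. -/
lemma degBF_add_majF_comp {m n : ℕ} (hm : 2 ≤ m) {σ : Fin m → Fin n}
    (hσ : Function.Injective σ) (L : BF n) (hL : ∀ α, 2 < wtv α → anf L α = 0)
    (hL0 : ∀ u : Fin n → ZMod 2, (∀ i, u i = 1 → i ∈ Set.range σ) → L u = 0) :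
    degBF (fun u => L u + majF m fun i => u (σ i)) = 2 ^ Nat.log 2 m := by
  have hle : 2 ^ Nat.log 2 m ≤ m := Nat.pow_log_le_self 2 (by omega)
  have hlt : m < 2 * 2 ^ Nat.log 2 m := by
    simpa [pow_succ, mul_comm] using Nat.lt_pow_succ_log_self (b := 2) (by norm_num) m
  have h2 : 2 ≤ 2 ^ Nat.log 2 m :=
    Nat.le_self_pow (Nat.log_pos (by norm_num) hm).ne' 2
  apply le_antisymm
  · refine Finset.sup_le fun α hα => ?_
    rw [Finset.mem_filter] at hα
    by_contra! hw
    apply hα.2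
    rw [anf_add, hL α (by omega), zero_add]
    by_cases hs : ∀ i, α i = 1 → i ∈ Set.range σ
    · have hwm := wtv_le_of_supported hs
      rw [anf_majF_comp hσ hs (w := 2 ^ Nat.log 2 m + (wtv α - 1 - 2 ^ Nat.log 2 m)) (by omega)]
      exact choose_two_pow_add _ _ _ (by omega) (by omega)
    · push Not at hs
      obtain ⟨i, hi, hiσ⟩ := hs
      refine anf_eq_zero_of_indep i hi fun u v h => ?_
      congr 1
      funext j
      exact h _ fun hj => hiσ ⟨j, hj⟩
  · obtain ⟨T, -, hT⟩ := Finset.exists_subset_card_eq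
      (show 2 ^ Nat.log 2 m ≤ (Finset.univ : Finset (Fin m)).card by simpa using hle)
    have hs : ∀ i, indVec (T.image σ) i = 1 → i ∈ Set.range σ := fun i hi => by
      obtain ⟨j, -, rfl⟩ := Finset.mem_image.1 (indVec_eq_one.1 hi)
      exact ⟨j, rfl⟩
    have hw : wtv (indVec (T.image σ)) = 2 ^ Nat.log 2 m := by
      rw [wtv_eq_card_suppVec, suppVec_indVec, Finset.card_image_of_injective _ hσ, hT]
    rw [← hw]
    refine Finset.le_sup (f := wtv) (Finset.mem_filter.2 ⟨Finset.mem_univ _, ?_⟩)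
    have hzero : anf L (indVec (T.image σ)) = 0 :=
      Finset.sum_eq_zero fun z hz => hL0 z fun i hi => hs i ((Finset.mem_filter.1 hz).2 i hi)
    rw [anf_add, hzero, zero_add, anf_majF_comp hσ hs (w := 2 ^ Nat.log 2 m - 1) (by omega),
      choose_two_pow_sub_one _ _ (by omega)]
    exact one_ne_zero

lemma eq_zero_of_ne_one {a : ZMod 2} (h : a ≠ 1) : a = 0 := by
  revert a
  decide

/-- For n ≥ 4, the degree of (Maj,rev)-MM_n is 2^⌊log₂⌊n/2⌋⌋ (here n = 2m or
n = 2m+1, so ⌊n/2⌋ = m). -/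
theorem deg_MMrev (m : ℕ) :
    (4 ≤ m + m → degBF (MMrevEven m) = 2 ^ Nat.log 2 m) ∧
    (4 ≤ m + m + 1 → degBF (MMrevOdd m) = 2 ^ Nat.log 2 m) := by
  constructor
  · intro h
    refine degBF_add_majF_comp (by omega) (Fin.castAdd_injective m m) _ ?_ ?_
    · intro α hα
      exact (anf_sum _ _ _).trans (Finset.sum_eq_zero fun i _ => anf_mul_eq_zero _ _ hα)
    · intro u hu
      refine Finset.sum_eq_zero fun i _ => ?_
      refine mul_eq_zero_of_right _ (eq_zero_of_ne_one fun hi => ?_)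
      obtain ⟨j, hj⟩ := hu _ hi
      have := congrArg Fin.val hj
      simp only [Fin.val_castAdd, Fin.val_natAdd] at this
      omega
  · intro h
    have hF : MMrevOdd m = fun u =>
        (u (Fin.last (m + m)) + ip (revPerm m fun i => u (Fin.castAdd m i).castSucc)
          (fun i => u (Fin.natAdd m i).castSucc)) +
          majF m (fun i => u (Fin.castAdd m i).castSucc) :=
      funext fun u => (add_assoc _ _ _).symm
    rw [hF]
    refine degBF_add_majF_comp (σ := fun i => (Fin.castAdd m i).castSucc) (by omega)
      ((Fin.castSucc_injective _).comp (Fin.castAdd_injective m m)) _ ?_ ?_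
    · intro α hα
      rw [anf_add, anf_coord_eq_zero _ hα, zero_add]
      exact (anf_sum _ _ _).trans (Finset.sum_eq_zero fun i _ => anf_mul_eq_zero _ _ hα)
    · intro u hu
      have hlast : u (Fin.last (m + m)) = 0 := eq_zero_of_ne_one fun hi => by
        obtain ⟨j, hj⟩ := hu _ hi
        have := congrArg Fin.val hj
        simp only [Fin.val_castSucc, Fin.val_castAdd, Fin.val_last] at this
        omega
      rw [hlast, zero_add]
      refine Finset.sum_eq_zero fun i _ => ?_
      refine mul_eq_zero_of_right _ (eq_zero_of_ne_one fun hi => ?_)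
      obtain ⟨j, hj⟩ := hu _ hi
      have := congrArg Fin.val hj
      simp only [Fin.val_castSucc, Fin.val_castAdd, Fin.val_natAdd] at this
      omega
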